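/- Let Q ⊆ ℤ^n, Ψ : ℤ^n → (0,1/2], 0 < s < s(Q,Ψ), and let M ≥ 2 with Q'(M) finite and nonempty. Then F̂_M(0) = 1; |F̂_M(ℓ)| ≤ 1 for all ℓ ∈ ℤ^{mn}; and F̂_M(ℓ) = 0 for every ℓ ∈ ℤ^{mn} with 0 < |ℓ| ≤ (M/(2 (log₂ M)^{n+1}))^{1/(2mn)}. -/

import Mathlib

noncomputable section

/-- `Ψ_*(q) = Ψ(q)/|q|` (max norm on `ℤ^n`). -/
def PsiStar {n : ℕ} (Ψ : (Fin n → ℤ) → ℝ) (q : Fin n → ℤ) : ℝ := Ψ q / ‖q‖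

/-- `s(Q,Ψ) = inf {s ≥ 0 : ∑_{q ∈ Q} Ψ_*(q)^s < ∞}`. -/
def sExp {n : ℕ} (Q : Set (Fin n → ℤ)) (Ψ : (Fin n → ℤ) → ℝ) : ℝ :=
  sInf {s : ℝ | 0 ≤ s ∧ Summable fun q : Q => PsiStar Ψ q ^ s}

/-- `Q(M) = {q ∈ Q : M/2 < Ψ_*(q)^{-s} ≤ M}`. -/
def QM {n : ℕ} (Q : Set (Fin n → ℤ)) (Ψ : (Fin n → ℤ) → ℝ) (s M : ℝ) : Set (Fin n → ℤ) :=
  {q | q ∈ Q ∧ M / 2 < PsiStar Ψ q ^ (-s) ∧ PsiStar Ψ q ^ (-s) ≤ M}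

/-- `𝓜 = {2^k : k ∈ ℕ, ∑_{q ∈ Q(2^k)} Ψ_*(q)^s ≥ k^{-(n+1)}}`. -/
def Mcal {n : ℕ} (Q : Set (Fin n → ℤ)) (Ψ : (Fin n → ℤ) → ℝ) (s : ℝ) : Set ℝ :=
  {M | ∃ k : ℕ, M = 2 ^ k ∧
    (((k : ℝ) ^ (n + 1))⁻¹ : ℝ) ≤ ∑' q : QM Q Ψ s (2 ^ k), PsiStar Ψ q ^ s}

end
/-- The set of divisors `D(ℓ) = {q ∈ ℤ^n : ∃ k ∈ ℤ^m, ℓ_{ij} = k_i q_j for all i,j}` of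
`ℓ ∈ ℤ^{mn}` (identified with an `m × n` integer matrix). -/
def Dset (m n : ℕ) (l : Fin m × Fin n → ℤ) : Set (Fin n → ℤ) :=
  {q | ∃ k : Fin m → ℤ, ∀ i j, l (i, j) = k i * q j}

/-- `L(M) = {ℓ ∈ ℤ^{mn} : 0 < |ℓ| ≤ (M/(2 (log₂ M)^{n+1}))^{1/(2mn)}}`. -/
noncomputable def LM (m n : ℕ) (M : ℝ) : Set (Fin m × Fin n → ℤ) :=
  {l | l ≠ 0 ∧ ‖l‖ ≤ (M / (2 * Real.logb 2 M ^ (n + 1))) ^ ((1 : ℝ) / (2 * m * n))}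

/-- `Q'(M) = Q(M) \ ⋃_{ℓ ∈ L(M)} D(ℓ)`. -/
noncomputable def QM' {n : ℕ} (m : ℕ) (Q : Set (Fin n → ℤ)) (Ψ : (Fin n → ℤ) → ℝ) (s M : ℝ) :
    Set (Fin n → ℤ) :=
  QM Q Ψ s M \ ⋃ l ∈ LM m n M, Dset m n l
noncomputable section

/-- The Fourier transform on `ℝ^m`: `φ̂(ξ) = ∫ e^{-2πi x·ξ} φ(x) dx`. -/
def ftRm {m : ℕ} (φ : (Fin m → ℝ) → ℝ) (ξ : Fin m → ℝ) : ℂ :=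
  ∫ x : Fin m → ℝ,
    Complex.exp (((-(2 * Real.pi * ∑ i, x i * ξ i) : ℝ) : ℂ) * Complex.I) * (φ x : ℂ)

/-- The `ℤ^m`-periodization `Φ^ε(y) = ∑_{r ∈ ℤ^m} ε^{-m} φ(ε^{-1}(y - r))`. -/
def PhiEps {m : ℕ} (φ : (Fin m → ℝ) → ℝ) (ε : ℝ) (y : Fin m → ℝ) : ℝ :=
  ∑' r : Fin m → ℤ, (ε ^ m)⁻¹ * φ (fun i => (y i - (r i : ℝ)) / ε)

/-- `Φ^ε_{q,θ}(x) = Φ^ε(xq - θ)` for `x ∈ ℝ^{mn}` identified with an `m × n` matrix. -/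
def PhiQ {m n : ℕ} (φ : (Fin m → ℝ) → ℝ) (ε : ℝ) (q : Fin n → ℤ) (θ : Fin m → ℝ)
    (x : Fin m × Fin n → ℝ) : ℝ :=
  PhiEps φ ε (fun i => (∑ j : Fin n, x (i, j) * (q j : ℝ)) - θ i)

/-- The `ℓ`-th Fourier coefficient `∫_{[0,1]^{mn}} f(x) e^{-2πi ℓ·x} dx` of a
`ℤ^{mn}`-periodic function. -/
def fcoef {m n : ℕ} (f : (Fin m × Fin n → ℝ) → ℝ) (l : Fin m × Fin n → ℤ) : ℂ :=
  ∫ x in {x : Fin m × Fin n → ℝ | ∀ p, x p ∈ Set.Icc (0 : ℝ) 1},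
    (f x : ℂ) * Complex.exp (((-(2 * Real.pi * ∑ p, x p * (l p : ℝ)) : ℝ) : ℂ) * Complex.I)

end
/-- `F_M(x) = |Q'|⁻¹ ∑_{q ∈ Q'} Φ^{Ψ(q)}_{q,θ}(x)`. -/
noncomputable def FM {m n : ℕ} (φ : (Fin m → ℝ) → ℝ) (Ψ : (Fin n → ℤ) → ℝ) (θ : Fin m → ℝ)
    (Q' : Set (Fin n → ℤ)) (x : Fin m × Fin n → ℝ) : ℝ :=
  ((Q'.ncard : ℝ))⁻¹ * ∑' q : Q', PhiQ φ (Ψ q) q θ x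

open MeasureTheory

/-- The closed unit cube `[0,1]^ι`. -/
def unitCube (ι : Type*) : Set (ι → ℝ) := {x | ∀ p, x p ∈ Set.Icc (0 : ℝ) 1}

/-- The lattice `ℤ^ι` inside `ℝ^ι`. -/
abbrev intLattice (ι : Type*) [Finite ι] : AddSubgroup (ι → ℝ) :=
  (Submodule.span ℤ (Set.range (Pi.basisFun ℝ ι))).toAddSubgroup

section Cube

variable {ι : Type*} [Fintype ι]

lemma fundamentalDomain_ae_eq_unitCube :
    ZSpan.fundamentalDomain (Pi.basisFun ℝ ι) =ᵐ[volume] unitCube ι := by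
  rw [ZSpan.fundamentalDomain_pi_basisFun]
  have h : unitCube ι = Set.Icc (fun _ => (0 : ℝ)) (fun _ => 1) := by
    ext x
    simp only [unitCube, Set.mem_ofPred_eq, Set.mem_Icc, Pi.le_def, forall_and]
  rw [h]
  exact Measure.univ_pi_Ico_ae_eq_Icc

/-- The coordinates of a point of the integer lattice. -/
noncomputable def intLatticeEquiv (ι : Type*) [Fintype ι] : intLattice ι ≃ (ι → ℤ) :=
  ((Pi.basisFun ℝ ι).restrictScalars ℤ).equivFun.toEquiv

instance : Countable (intLattice ι) := (intLatticeEquiv ι).injective.countable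

lemma intLatticeEquiv_apply (g : intLattice ι) (i : ι) :
    ((intLatticeEquiv ι g i : ℤ) : ℝ) = (g : ι → ℝ) i := by
  have h := (Pi.basisFun ℝ ι).restrictScalars_repr_apply ℤ g i
  simpa [intLatticeEquiv] using h

lemma vadd_eq_add_intLatticeEquiv (g : intLattice ι) (x : ι → ℝ) :
    g +ᵥ x = fun i => x i + (intLatticeEquiv ι g i : ℝ) := by
  funext i
  rw [intLatticeEquiv_apply, add_comm]
  rfl

lemma volume_restrict_unitCube :
    (volume : Measure (ι → ℝ)).restrict (unitCube ι) =
      volume.restrict (ZSpan.fundamentalDomain (Pi.basisFun ℝ ι)) :=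
  Measure.restrict_congr_set fundamentalDomain_ae_eq_unitCube.symm

lemma volume_unitCube : volume (unitCube ι) = 1 := by
  rw [← measure_congr fundamentalDomain_ae_eq_unitCube, ZSpan.fundamentalDomain_pi_basisFun,
    volume_pi, Measure.pi_pi]
  simp

/-- The integral of a periodic function over the unit cube is translation invariant. -/
lemma setLIntegral_unitCube_add (f : (ι → ℝ) → ENNReal)
    (hf : ∀ (r : ι → ℤ) x, f (fun i => x i + (r i : ℝ)) = f x) (v : ι → ℝ) :
    ∫⁻ x in unitCube ι, f (v + x) = ∫⁻ x in unitCube ι, f x := by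
  have hd := ZSpan.isAddFundamentalDomain' (Pi.basisFun ℝ ι) volume
  have h := (hd.vadd_of_comm v).setLIntegral_eq hd f
    (fun g x => by rw [vadd_eq_add_intLatticeEquiv, hf])
  rw [volume_restrict_unitCube, ← h]
  exact (measurePreserving_vadd v volume).setLIntegral_comp_emb
    (measurableEmbedding_const_vadd v) f _

/-- The integral of a periodic function over the unit cube is translation invariant. -/
lemma setIntegral_unitCube_add (f : (ι → ℝ) → ℂ)
    (hf : ∀ (r : ι → ℤ) x, f (fun i => x i + (r i : ℝ)) = f x) (v : ι → ℝ) :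
    ∫ x in unitCube ι, f (v + x) = ∫ x in unitCube ι, f x := by
  have hd := ZSpan.isAddFundamentalDomain' (Pi.basisFun ℝ ι) volume
  have h := (hd.vadd_of_comm v).setIntegral_eq hd (f := f)
    (fun g x => by rw [vadd_eq_add_intLatticeEquiv, hf])
  rw [volume_restrict_unitCube, ← h]
  exact ((measurePreserving_vadd v volume).setIntegral_image_emb
    (measurableEmbedding_const_vadd v) f _).symm

/-- Unfolding: the integral over the cube of a periodization is the integral over the space. -/
lemma setLIntegral_unitCube_tsum (f : (ι → ℝ) → ENNReal) (hf : Measurable f) :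
    ∫⁻ x in unitCube ι, ∑' r : ι → ℤ, f (fun i => x i - (r i : ℝ)) = ∫⁻ x, f x := by
  have hd := ZSpan.isAddFundamentalDomain' (Pi.basisFun ℝ ι) volume
  rw [lintegral_tsum (fun r => Measurable.aemeasurable (by fun_prop)), hd.lintegral_eq_tsum'' f,
    ← volume_restrict_unitCube]
  rw [← ((intLatticeEquiv ι).trans (Equiv.neg _)).tsum_eq]
  simp only [Equiv.trans_apply, Equiv.neg_apply, Pi.neg_apply, Int.cast_neg, sub_neg_eq_add,
    vadd_eq_add_intLatticeEquiv]

end Cube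

/-- The periodization `Φ^ε` with values in `[0,∞]`. -/
noncomputable def ePhiEps {m : ℕ} (φ : (Fin m → ℝ) → ℝ) (ε : ℝ) (y : Fin m → ℝ) : ENNReal :=
  ∑' r : Fin m → ℤ, ENNReal.ofReal ((ε ^ m)⁻¹ * φ (fun i => (y i - (r i : ℝ)) / ε))

section Periodization

variable {m n : ℕ} {φ : (Fin m → ℝ) → ℝ} {ε : ℝ}

lemma PhiEps_eq_toReal (hφ0 : ∀ x, 0 ≤ φ x) (hε : 0 < ε) (y : Fin m → ℝ) :
    PhiEps φ ε y = (ePhiEps φ ε y).toReal := by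
  rw [ePhiEps, ENNReal.tsum_toReal_eq (fun _ => ENNReal.ofReal_ne_top), PhiEps]
  refine tsum_congr fun r => (ENNReal.toReal_ofReal ?_).symm
  have := hφ0 (fun i => (y i - (r i : ℝ)) / ε)
  positivity

lemma measurable_ePhiEps (hmeas : Measurable φ) : Measurable (ePhiEps φ ε) := by
  unfold ePhiEps
  fun_prop

lemma ePhiEps_add_int (y : Fin m → ℝ) (r : Fin m → ℤ) :
    ePhiEps φ ε (fun i => y i + (r i : ℝ)) = ePhiEps φ ε y := by
  unfold ePhiEps
  rw [← (Equiv.addRight r).tsum_eq]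
  simp

lemma setLIntegral_ePhiEps (hφ0 : ∀ x, 0 ≤ φ x) (hmeas : Measurable φ)
    (hint : ∫ x, φ x = 1) (hε : 0 < ε) :
    ∫⁻ y in unitCube (Fin m), ePhiEps φ ε y = 1 := by
  have hφi : Integrable φ := by
    by_contra h
    rw [integral_undef h] at hint
    exact zero_ne_one hint
  have hdiv : ∀ x : Fin m → ℝ, (fun i => x i / ε) = ε⁻¹ • x := fun x => by
    funext i
    simp [div_eq_inv_mul]
  refine (setLIntegral_unitCube_tsum
    (fun x => ENNReal.ofReal ((ε ^ m)⁻¹ * φ (fun i => x i / ε))) (by fun_prop)).trans ?_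
  simp only [hdiv]
  rw [← ofReal_integral_eq_lintegral_ofReal
    ((hφi.comp_smul (inv_ne_zero hε.ne')).const_mul _)
    (Filter.Eventually.of_forall fun x => mul_nonneg (by positivity) (hφ0 _)),
    integral_const_mul, Measure.integral_comp_inv_smul_of_nonneg _ _ hε.le, hint]
  simp [hε.ne']

/-- The matrix whose `j`-th column is `t / q_j` and whose other columns vanish. -/
noncomputable def columnShift (q : Fin n → ℤ) (j : Fin n) (t : Fin m → ℝ) :
    Fin m × Fin n → ℝ :=
  fun p => if p.2 = j then t p.1 / q j else 0

/-- The affine map `x ↦ xq - θ`. -/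
def mulSub (q : Fin n → ℤ) (θ : Fin m → ℝ) (x : Fin m × Fin n → ℝ) : Fin m → ℝ :=
  fun i => (∑ j : Fin n, x (i, j) * (q j : ℝ)) - θ i

lemma mulSub_add (q : Fin n → ℤ) (θ : Fin m → ℝ) (v x : Fin m × Fin n → ℝ) :
    mulSub q θ (v + x) = mulSub q θ x + mulSub q 0 v := by
  funext i
  simp only [mulSub, Pi.add_apply, add_mul, Finset.sum_add_distrib, Pi.zero_apply]
  ring

lemma mulSub_columnShift {q : Fin n → ℤ} {j : Fin n} (hj : q j ≠ 0) (t : Fin m → ℝ) :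
    mulSub q 0 (columnShift q j t) = t := by
  have : (q j : ℝ) ≠ 0 := by exact_mod_cast hj
  funext i
  simp [mulSub, columnShift, this]

lemma measurable_mulSub (q : Fin n → ℤ) (θ : Fin m → ℝ) : Measurable (mulSub q θ) := by
  unfold mulSub
  fun_prop

lemma mulSub_add_int (q : Fin n → ℤ) (θ : Fin m → ℝ) (x : Fin m × Fin n → ℝ)
    (r : Fin m × Fin n → ℤ) :
    mulSub q θ (fun p => x p + (r p : ℝ)) =
      fun i => mulSub q θ x i + ((∑ j, r (i, j) * q j : ℤ) : ℝ) := by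
  funext i
  simp only [mulSub, add_mul, Finset.sum_add_distrib, Int.cast_sum, Int.cast_mul]
  ring

lemma PhiQ_eq_toReal (hφ0 : ∀ x, 0 ≤ φ x) (hε : 0 < ε) (q : Fin n → ℤ) (θ : Fin m → ℝ)
    (x : Fin m × Fin n → ℝ) : PhiQ φ ε q θ x = (ePhiEps φ ε (mulSub q θ x)).toReal :=
  PhiEps_eq_toReal hφ0 hε _

lemma setLIntegral_ePhiEps_mulSub (hφ0 : ∀ x, 0 ≤ φ x) (hmeas : Measurable φ)
    (hint : ∫ x, φ x = 1) (hε : 0 < ε) {q : Fin n → ℤ} (hq : q ≠ 0) (θ : Fin m → ℝ) :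
    ∫⁻ x in unitCube (Fin m × Fin n), ePhiEps φ ε (mulSub q θ x) = 1 := by
  obtain ⟨j, hj⟩ := Function.ne_iff.mp hq
  have hH := measurable_ePhiEps (ε := ε) hmeas
  have hA := measurable_mulSub q θ
  have hshift : ∀ t : Fin m → ℝ,
      ∫⁻ x in unitCube (Fin m × Fin n), ePhiEps φ ε (mulSub q θ x + t) =
        ∫⁻ x in unitCube (Fin m × Fin n), ePhiEps φ ε (mulSub q θ x) := fun t => by
    rw [← setLIntegral_unitCube_add (fun x => ePhiEps φ ε (mulSub q θ x))
      (fun r x => by rw [mulSub_add_int, ePhiEps_add_int]) (columnShift q j t)]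
    simp only [mulSub_add, mulSub_columnShift hj]
  calc ∫⁻ x in unitCube (Fin m × Fin n), ePhiEps φ ε (mulSub q θ x)
      = ∫⁻ t in unitCube (Fin m), ∫⁻ x in unitCube (Fin m × Fin n),
          ePhiEps φ ε (mulSub q θ x + t) := by
        simp only [hshift, lintegral_const, Measure.restrict_apply_univ, volume_unitCube, mul_one]
    _ = ∫⁻ x in unitCube (Fin m × Fin n), ∫⁻ t in unitCube (Fin m),
          ePhiEps φ ε (mulSub q θ x + t) :=
        lintegral_lintegral_swap (by fun_prop)
    _ = 1 := by
        simp only [setLIntegral_unitCube_add (ePhiEps φ ε) (fun r x => ePhiEps_add_int x r),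
          setLIntegral_ePhiEps hφ0 hmeas hint hε, lintegral_const, Measure.restrict_apply_univ,
          volume_unitCube, mul_one]

lemma integrableOn_PhiQ (hφ0 : ∀ x, 0 ≤ φ x) (hmeas : Measurable φ)
    (hint : ∫ x, φ x = 1) (hε : 0 < ε) {q : Fin n → ℤ} (hq : q ≠ 0) (θ : Fin m → ℝ) :
    IntegrableOn (PhiQ φ ε q θ) (unitCube (Fin m × Fin n)) := by
  have h := setLIntegral_ePhiEps_mulSub hφ0 hmeas hint hε hq θ
  refine (integrable_toReal_of_lintegral_ne_top
    (f := fun x => ePhiEps φ ε (mulSub q θ x))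
    ((measurable_ePhiEps hmeas).comp (measurable_mulSub q θ)).aemeasurable
    (by simp [h])).congr (Filter.Eventually.of_forall fun x => ?_)
  exact (PhiQ_eq_toReal hφ0 hε q θ x).symm

lemma setIntegral_PhiQ (hφ0 : ∀ x, 0 ≤ φ x) (hmeas : Measurable φ)
    (hint : ∫ x, φ x = 1) (hε : 0 < ε) {q : Fin n → ℤ} (hq : q ≠ 0) (θ : Fin m → ℝ) :
    ∫ x in unitCube (Fin m × Fin n), PhiQ φ ε q θ x = 1 := by
  have h := setLIntegral_ePhiEps_mulSub hφ0 hmeas hint hε hq θ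
  have hm : Measurable fun x => ePhiEps φ ε (mulSub q θ x) :=
    (measurable_ePhiEps hmeas).comp (measurable_mulSub q θ)
  simp only [PhiQ_eq_toReal hφ0 hε]
  rw [integral_toReal hm.aemeasurable (ae_lt_top hm (by simp [h])), h, ENNReal.toReal_one]

/-- The character `x ↦ e^{-2πi ℓ·x}` of `ℝ^d`. -/
noncomputable def fchar {ι : Type*} [Fintype ι] (l : ι → ℤ) (x : ι → ℝ) : ℂ :=
  Complex.exp (((-(2 * Real.pi * ∑ p, x p * (l p : ℝ)) : ℝ) : ℂ) * Complex.I)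

section Character

variable {ι : Type*} [Fintype ι]

lemma norm_fchar (l : ι → ℤ) (x : ι → ℝ) : ‖fchar l x‖ = 1 :=
  Complex.norm_exp_ofReal_mul_I _

lemma measurable_fchar (l : ι → ℤ) : Measurable (fchar l) := by
  unfold fchar
  fun_prop

lemma fchar_add (l : ι → ℤ) (v x : ι → ℝ) : fchar l (v + x) = fchar l v * fchar l x := by
  rw [fchar, fchar, fchar, ← Complex.exp_add]
  congr 1
  simp only [Pi.add_apply, add_mul, Finset.sum_add_distrib]
  push_cast
  ring

lemma fchar_eq_one_iff (l : ι → ℤ) (v : ι → ℝ) :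
    fchar l v = 1 ↔ ∃ k : ℤ, ∑ p, v p * (l p : ℝ) = k := by
  have hpi : (2 * Real.pi : ℝ) ≠ 0 := by positivity
  rw [fchar, Complex.exp_eq_one_iff]
  constructor
  · rintro ⟨k, hk⟩
    refine ⟨-k, ?_⟩
    have h1 := congrArg Complex.im hk
    simp at h1
    apply mul_left_cancel₀ hpi
    push_cast
    linarith
  · rintro ⟨k, hk⟩
    refine ⟨-k, ?_⟩
    rw [hk]
    push_cast
    ring

end Character

lemma fcoef_eq (f : (Fin m × Fin n → ℝ) → ℝ) (l : Fin m × Fin n → ℤ) :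
    fcoef f l = ∫ x in unitCube (Fin m × Fin n), (f x : ℂ) * fchar l x := rfl

lemma fcoef_zero (f : (Fin m × Fin n → ℝ) → ℝ) :
    fcoef f 0 = ((∫ x in unitCube (Fin m × Fin n), f x : ℝ) : ℂ) := by
  rw [fcoef_eq, ← integral_complex_ofReal]
  simp [fchar]

lemma norm_fcoef_le (f : (Fin m × Fin n → ℝ) → ℝ) (hf : ∀ x, 0 ≤ f x)
    (l : Fin m × Fin n → ℤ) :
    ‖fcoef f l‖ ≤ ∫ x in unitCube (Fin m × Fin n), f x := by
  rw [fcoef_eq]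
  refine (norm_integral_le_integral_norm _).trans_eq ?_
  simp [norm_fchar, abs_of_nonneg (hf _)]

/-- If a shift preserving `f` is not killed by the character of `ℓ`, then `f̂(ℓ) = 0`. -/
lemma fcoef_eq_zero_of_shift (f : (Fin m × Fin n → ℝ) → ℝ) (l : Fin m × Fin n → ℤ)
    (hper : ∀ (r : Fin m × Fin n → ℤ) x, f (fun p => x p + (r p : ℝ)) = f x)
    (v : Fin m × Fin n → ℝ) (hv : ∀ x, f (v + x) = f x) (hl : fchar l v ≠ 1) :
    fcoef f l = 0 := by
  have hint : ∀ r : Fin m × Fin n → ℤ, fchar l (fun p => (r p : ℝ)) = 1 := fun r =>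
    (fchar_eq_one_iff l _).mpr ⟨∑ p, r p * l p, by push_cast; rfl⟩
  have h := setIntegral_unitCube_add (fun x => (f x : ℂ) * fchar l x) (fun r x => by
    have hadd : (fun p => x p + (r p : ℝ)) = x + fun p => (r p : ℝ) := rfl
    rw [hper, hadd, fchar_add, hint, mul_one]) v
  simp only [hv, fchar_add, mul_left_comm, integral_const_mul, ← fcoef_eq] at h
  by_contra hne
  exact hl ((mul_eq_right₀ hne).mp h)

lemma fcoef_PhiQ_eq_zero (hφ0 : ∀ x, 0 ≤ φ x) (hε : 0 < ε) {q : Fin n → ℤ} (hq : q ≠ 0)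
    (θ : Fin m → ℝ) {l : Fin m × Fin n → ℤ} (hl : q ∉ Dset m n l) :
    fcoef (PhiQ φ ε q θ) l = 0 := by
  by_contra hne
  apply hl
  obtain ⟨j, hj⟩ := Function.ne_iff.mp hq
  have hj' : (q j : ℝ) ≠ 0 := by exact_mod_cast hj
  have key : ∀ v : Fin m × Fin n → ℝ, (∃ r : Fin m → ℤ, mulSub q 0 v = fun i => (r i : ℝ)) →
      ∃ k : ℤ, ∑ p, v p * (l p : ℝ) = k := by
    rintro v ⟨r, hr⟩
    rw [← fchar_eq_one_iff]
    by_contra hv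
    refine hne (fcoef_eq_zero_of_shift _ l (fun r x => ?_) v (fun x => ?_) hv)
    · rw [PhiQ_eq_toReal hφ0 hε, PhiQ_eq_toReal hφ0 hε, mulSub_add_int, ePhiEps_add_int]
    · rw [PhiQ_eq_toReal hφ0 hε, PhiQ_eq_toReal hφ0 hε, mulSub_add, hr]
      exact congrArg _ (ePhiEps_add_int _ r)
  have hdvd : ∀ i, ∃ k : ℤ, l (i, j) = k * q j := fun i => by
    obtain ⟨k, hk⟩ := key (columnShift q j (fun i' => ((Pi.single i 1 : Fin m → ℤ) i' : ℝ)))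
      ⟨Pi.single i 1, mulSub_columnShift hj _⟩
    refine ⟨k, ?_⟩
    rw [Fintype.sum_prod_type, Finset.sum_eq_single i, Finset.sum_eq_single j] at hk
    · simp only [columnShift, if_true, Pi.single_eq_same] at hk
      field_simp at hk
      exact_mod_cast (by simpa using hk : (l (i, j) : ℝ) = q j * k).trans (mul_comm _ _)
    · intro b _ hb
      simp [columnShift, hb]
    · simp
    · intro b _ hb
      simp [columnShift, Pi.single_eq_of_ne hb]
    · simp
  choose k hk using hdvd
  refine ⟨k, fun i b => ?_⟩
  by_contra hib
  have hbj : b ≠ j := fun h => hib (h ▸ hk i)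
  -- the shift by a half of `(q_j e_{ib} - q_b e_{ij}) / c` with `c = q_j (ℓ_{ib} - k_i q_b)`
  set c : ℝ := q j * (l (i, b) - k i * q b) with hc
  have hc0 : c ≠ 0 := by
    refine mul_ne_zero hj' (sub_ne_zero.mpr ?_)
    exact_mod_cast hib
  obtain ⟨z, hz⟩ := key
    (Pi.single (i, b) (q j / (2 * c)) + Pi.single (i, j) (-(q b / (2 * c)))) ⟨0, by
      funext a
      by_cases ha : a = i
      · subst ha
        simp [mulSub, Pi.single_apply, add_mul, Finset.sum_add_distrib]
        ring
      · simp [mulSub, ha]⟩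
  simp only [Pi.add_apply, add_mul, Finset.sum_add_distrib, Pi.single_apply, ite_mul, zero_mul,
    Finset.sum_ite_eq', Finset.mem_univ, if_true, hk i] at hz
  have hhalf : (z : ℝ) = 1 / 2 := by
    rw [← hz]
    have : (q j : ℝ) / (2 * c) * l (i, b) + -(q b / (2 * c)) * ((k i * q j : ℤ) : ℝ)
        = c / (2 * c) := by
      rw [hc]
      push_cast
      ring
    rw [this]
    field_simp
  have h2 : (2 * z : ℤ) = 1 := by
    have : (2 * z : ℝ) = 1 := by rw [hhalf]; norm_num
    exact_mod_cast this
  omega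

lemma fcoef_const_mul_sum (c : ℝ) {α : Type*} (S : Finset α)
    (f : α → (Fin m × Fin n → ℝ) → ℝ)
    (hf : ∀ a ∈ S, IntegrableOn (f a) (unitCube (Fin m × Fin n))) (l : Fin m × Fin n → ℤ) :
    fcoef (fun x => c * ∑ a ∈ S, f a x) l = c * ∑ a ∈ S, fcoef (f a) l := by
  simp only [fcoef_eq]
  push_cast
  simp only [mul_assoc, Finset.sum_mul]
  rw [integral_const_mul, integral_finsetSum]
  intro a ha
  refine (hf a ha).ofReal.mul_bdd (c := 1) (measurable_fchar l).aestronglyMeasurable ?_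
  exact Filter.Eventually.of_forall fun x => (norm_fchar l x).le

end Periodization

lemma ne_zero_of_mem_QM {n : ℕ} {Q : Set (Fin n → ℤ)} {Ψ : (Fin n → ℤ) → ℝ} {s M : ℝ}
    (hs : 0 < s) (hM : 0 ≤ M) {q : Fin n → ℤ} (hq : q ∈ QM Q Ψ s M) : q ≠ 0 := by
  rintro rfl
  have h := hq.2.1
  rw [PsiStar, norm_zero, div_zero, Real.zero_rpow (by linarith)] at h
  linarith

lemma FM_coe_finset {m n : ℕ} (φ : (Fin m → ℝ) → ℝ) (Ψ : (Fin n → ℤ) → ℝ) (θ : Fin m → ℝ)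
    (S : Finset (Fin n → ℤ)) :
    FM φ Ψ θ (S : Set (Fin n → ℤ)) =
      fun x => (S.card : ℝ)⁻¹ * ∑ q ∈ S, PhiQ φ (Ψ q) q θ x := by
  funext x
  rw [FM, Set.ncard_coe_finset]
  congr 1
  exact Finset.tsum_subtype S (fun q => PhiQ φ (Ψ q) q θ x)

/-- Basic bounds on the Fourier coefficients of `F_M`: `F̂_M(0) = 1`, `|F̂_M(ℓ)| ≤ 1` for all
`ℓ`, and `F̂_M(ℓ) = 0` for `0 < |ℓ| ≤ (M/(2 (log₂ M)^{n+1}))^{1/(2mn)}`. -/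
theorem FM_fourierCoeff_bounds (m n : ℕ) (Q : Set (Fin n → ℤ)) (Ψ : (Fin n → ℤ) → ℝ)
    (hΨ : ∀ q, Ψ q ∈ Set.Ioc (0 : ℝ) (1 / 2)) (θ : Fin m → ℝ)
    (s : ℝ) (hs : 0 < s) (hss : s < sExp Q Ψ)
    (φ : (Fin m → ℝ) → ℝ) (hφ0 : ∀ x, 0 ≤ φ x) (hmeas : Measurable φ)
    (hsupp : Function.support φ ⊆ {x | ∀ i, x i ∈ Set.Ioo (-1 : ℝ) 1})
    (hint : ∫ x : Fin m → ℝ, φ x = 1)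
    (K : ℕ) (hK : (m * n : ℝ) + s < K) (C : ℝ)
    (hdecay : ∀ ξ : Fin m → ℝ, ‖ftRm φ ξ‖ ≤ C * (1 + ‖ξ‖) ^ (-(K : ℝ)))
    (M : ℝ) (hM : 2 ≤ M) (hfin : (QM' m Q Ψ s M).Finite) (hne : (QM' m Q Ψ s M).Nonempty) :
    fcoef (FM φ Ψ θ (QM' m Q Ψ s M)) 0 = 1 ∧
    (∀ l : Fin m × Fin n → ℤ, ‖fcoef (FM φ Ψ θ (QM' m Q Ψ s M)) l‖ ≤ 1) ∧
    (∀ l : Fin m × Fin n → ℤ, l ≠ 0 →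
      ‖l‖ ≤ (M / (2 * Real.logb 2 M ^ (n + 1))) ^ ((1 : ℝ) / (2 * m * n)) →
      fcoef (FM φ Ψ θ (QM' m Q Ψ s M)) l = 0) := by
  set S := hfin.toFinset with hS
  have hcard : (S.card : ℝ) ≠ 0 := by
    rw [Nat.cast_ne_zero, Finset.card_ne_zero, hS, Set.Finite.toFinset_nonempty]
    exact hne
  have hFM : FM φ Ψ θ (QM' m Q Ψ s M) =
      fun x => (S.card : ℝ)⁻¹ * ∑ q ∈ S, PhiQ φ (Ψ q) q θ x := by
    rw [← FM_coe_finset, hS, Set.Finite.coe_toFinset]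
  have hmem : ∀ q ∈ S, q ∈ QM' m Q Ψ s M := fun q hq => hfin.mem_toFinset.mp hq
  have hq0 : ∀ q ∈ S, q ≠ 0 := fun q hq =>
    ne_zero_of_mem_QM hs (by linarith) (hmem q hq).1
  have hcoef : ∀ l, fcoef (FM φ Ψ θ (QM' m Q Ψ s M)) l =
      ((S.card : ℝ)⁻¹ : ℝ) * ∑ q ∈ S, fcoef (PhiQ φ (Ψ q) q θ) l := fun l => by
    rw [hFM]
    exact fcoef_const_mul_sum _ S (fun q => PhiQ φ (Ψ q) q θ)
      (fun q hq => integrableOn_PhiQ hφ0 hmeas hint (hΨ q).1 (hq0 q hq) θ) l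
  refine ⟨?_, fun l => ?_, fun l hl0 hl => ?_⟩
  · have h1 : ∀ q ∈ S, fcoef (PhiQ φ (Ψ q) q θ) 0 = 1 := fun q hq => by
      rw [fcoef_zero, setIntegral_PhiQ hφ0 hmeas hint (hΨ q).1 (hq0 q hq) θ, Complex.ofReal_one]
    rw [hcoef, Finset.sum_congr rfl h1, Finset.sum_const, nsmul_one]
    exact_mod_cast inv_mul_cancel₀ hcard
  · have h1 : ∀ q ∈ S, ‖fcoef (PhiQ φ (Ψ q) q θ) l‖ ≤ 1 := fun q hq =>
      (norm_fcoef_le _ (fun x => by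
        rw [PhiQ_eq_toReal hφ0 (hΨ q).1]
        exact ENNReal.toReal_nonneg) l).trans_eq
        (setIntegral_PhiQ hφ0 hmeas hint (hΨ q).1 (hq0 q hq) θ)
    rw [hcoef, norm_mul, Complex.norm_real, Real.norm_of_nonneg (by positivity)]
    refine (mul_le_mul_of_nonneg_left (norm_sum_le_of_le S h1) (by positivity)).trans_eq ?_
    rw [Finset.sum_const, nsmul_one]
    exact inv_mul_cancel₀ hcard
  · rw [hcoef, Finset.sum_eq_zero, mul_zero]
    refine fun q hq => fcoef_PhiQ_eq_zero hφ0 (hΨ q).1 (hq0 q hq) θ fun hD => ?_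
    exact (hmem q hq).2 (Set.mem_biUnion (show l ∈ LM m n M from ⟨hl0, hl⟩) hD)
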